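/- Let β > n and let X be a random vector in ℝⁿ with density f such that f^{-1/β} is convex on the support of f (i.e. f is (-1/β)-concave). Then the function α ↦ (∏_{i=1}^n ((1-α)β - i)) · E[f(X)^{-α}] is log-concave on (-∞, 1 - n/β). -/

import Mathlib

open MeasureTheory ProbabilityTheory Real
open scoped ENNReal Pointwise

theorem volume_add_volume_le_of_isCompact {K L : Set ℝ} (hK : IsCompact K) (hL : IsCompact L)
    (hKne : K.Nonempty) (hLne : L.Nonempty) : volume K + volume L ≤ volume (K + L) := by
  obtain ⟨a, ha⟩ := hK.exists_isGreatest hKne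
  obtain ⟨b, hb⟩ := hL.exists_isLeast hLne
  have hd : AEDisjoint volume (b +ᵥ K) (a +ᵥ L) := by
    refine measure_mono_null (t := {a + b}) ?_ (by simp)
    rintro x ⟨⟨y, hy, rfl⟩, ⟨z, hz, hzy⟩⟩
    have h1 := ha.2 hy
    have h2 := hb.2 hz
    simp only [vadd_eq_add] at hzy
    simp only [vadd_eq_add, Set.mem_singleton_iff]
    linarith
  have hU : volume ((b +ᵥ K) ∪ (a +ᵥ L)) = volume K + volume L := by
    rw [measure_union₀ (hL.vadd a).measurableSet.nullMeasurableSet hd, measure_vadd, measure_vadd]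
  rw [← hU]
  refine measure_mono (Set.union_subset ?_ ?_)
  · rintro _ ⟨y, hy, rfl⟩
    exact ⟨y, hy, b, hb.1, add_comm _ _⟩
  · rintro _ ⟨y, hy, rfl⟩
    exact ⟨a, ha.1, y, hy, rfl⟩

/-- The one-dimensional Brunn-Minkowski inequality. -/
theorem volume_add_volume_le {A B : Set ℝ} (hA : MeasurableSet A) (hB : MeasurableSet B)
    (hAne : A.Nonempty) (hBne : B.Nonempty) : volume A + volume B ≤ volume (A + B) := by
  have key : ∀ K, (K ⊆ A ∧ IsCompact K) → ∀ L, (L ⊆ B ∧ IsCompact L) →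
      volume K + volume L ≤ volume (A + B) := by
    rintro K ⟨hKA, hK⟩ L ⟨hLB, hL⟩
    obtain ⟨a, ha⟩ := hAne
    obtain ⟨b, hb⟩ := hBne
    rcases K.eq_empty_or_nonempty with rfl | hKne
    · rw [measure_empty, zero_add, ← measure_vadd volume a L]
      refine measure_mono ?_
      rintro _ ⟨y, hy, rfl⟩
      exact ⟨a, ha, y, hLB hy, rfl⟩
    rcases L.eq_empty_or_nonempty with rfl | hLne
    · rw [measure_empty, add_zero, ← measure_vadd volume b K]
      refine measure_mono ?_
      rintro _ ⟨y, hy, rfl⟩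
      exact ⟨y, hKA hy, b, hb, add_comm _ _⟩
    exact (volume_add_volume_le_of_isCompact hK hL hKne hLne).trans
      (measure_mono (Set.add_subset_add hKA hLB))
  rw [hA.measure_eq_iSup_isCompact volume, hB.measure_eq_iSup_isCompact volume]
  simp only [iSup_and']
  exact ENNReal.biSup_add_biSup_le' ⟨∅, by simp⟩ ⟨∅, by simp⟩ key

theorem ENNReal.geom_mean_le_arith_mean2_weighted {a b : ℝ} (ha : 0 < a) (hb : 0 < b)
    (hab : a + b = 1) (x y : ℝ≥0∞) :
    x ^ a * y ^ b ≤ ENNReal.ofReal a * x + ENNReal.ofReal b * y := by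
  have hpq : a⁻¹.HolderConjugate b⁻¹ :=
    Real.holderConjugate_iff.2 ⟨(one_lt_inv₀ ha).2 (by linarith), by simpa using hab⟩
  have h := ENNReal.young_inequality (x ^ a) (y ^ b) hpq
  rwa [← ENNReal.rpow_mul, ← ENNReal.rpow_mul, mul_inv_cancel₀ ha.ne', mul_inv_cancel₀ hb.ne',
    ENNReal.rpow_one, ENNReal.rpow_one, ENNReal.ofReal_inv_of_pos ha, ENNReal.ofReal_inv_of_pos hb,
    ENNReal.div_eq_inv_mul, ENNReal.div_eq_inv_mul, inv_inv, inv_inv] at h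

theorem lintegral_convexComb_le_of_iSup_eq_one {a b : ℝ} (ha : 0 < a) (hb : 0 < b) (hab : a + b = 1)
    {u v w : ℝ → ℝ≥0∞} (hu : Measurable u) (hv : Measurable v) (hw : Measurable w)
    (hu1 : ⨆ x, u x = 1) (hv1 : ⨆ x, v x = 1)
    (h : ∀ x y, u x ^ a * v y ^ b ≤ w (a * x + b * y)) :
    ENNReal.ofReal a * (∫⁻ x, u x) + ENNReal.ofReal b * (∫⁻ x, v x) ≤ ∫⁻ x, w x := by
  have layer : ∀ g : ℝ → ℝ≥0∞, Measurable g → (∀ x, g x ≤ 1) →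
      ∫⁻ x, g x = ∫⁻ t in Set.Ioi (0 : ℝ), volume {x | ENNReal.ofReal t < g x} := by
    intro g hg hg1
    have hfin : ∀ x, g x ≠ ∞ := fun x => ((hg1 x).trans_lt ENNReal.one_lt_top).ne
    have := lintegral_eq_lintegral_meas_lt volume (f := fun x => (g x).toReal)
      (Filter.Eventually.of_forall fun _ => ENNReal.toReal_nonneg) hg.ennreal_toReal.aemeasurable
    simp only [ENNReal.ofReal_toReal (hfin _)] at this
    rw [this]
    refine setLIntegral_congr_fun measurableSet_Ioi fun t ht => ?_
    simp only [ENNReal.ofReal_lt_iff_lt_toReal (le_of_lt ht) (hfin _)]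
  have hule : ∀ x, u x ≤ 1 := fun x => hu1 ▸ le_iSup u x
  have hvle : ∀ x, v x ≤ 1 := fun x => hv1 ▸ le_iSup v x
  have hmono : ∀ g : ℝ → ℝ≥0∞, Measurable fun t : ℝ => volume {x | ENNReal.ofReal t < g x} := by
    intro g
    refine Antitone.measurable fun s t hst => measure_mono fun x hx => ?_
    exact (ENNReal.ofReal_le_ofReal hst).trans_lt hx
  calc _ = ∫⁻ t in Set.Ioi (0 : ℝ), (ENNReal.ofReal a * volume {x | ENNReal.ofReal t < u x}
            + ENNReal.ofReal b * volume {x | ENNReal.ofReal t < v x}) := by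
        rw [layer u hu hule, layer v hv hvle, lintegral_add_left ((hmono u).const_mul _),
          lintegral_const_mul _ (hmono u), lintegral_const_mul _ (hmono v)]
    _ ≤ ∫⁻ t in Set.Ioi (0 : ℝ), volume {x | ENNReal.ofReal t < min (w x) 1} := by
        refine setLIntegral_mono' measurableSet_Ioi fun t ht => ?_
        rcases le_or_gt 1 (ENNReal.ofReal t) with h1 | h1
        · have e1 : {x | ENNReal.ofReal t < u x} = ∅ :=
            Set.eq_empty_of_forall_notMem fun x hx => ((h1.trans_lt hx).trans_le (hule x)).false
          have e2 : {x | ENNReal.ofReal t < v x} = ∅ :=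
            Set.eq_empty_of_forall_notMem fun x hx => ((h1.trans_lt hx).trans_le (hvle x)).false
          simp [e1, e2]
        · have n1 : {x | ENNReal.ofReal t < u x}.Nonempty := by
            obtain ⟨x, hx⟩ := lt_iSup_iff.1 (h1.trans_eq hu1.symm)
            exact ⟨x, hx⟩
          have n2 : {x | ENNReal.ofReal t < v x}.Nonempty := by
            obtain ⟨x, hx⟩ := lt_iSup_iff.1 (h1.trans_eq hv1.symm)
            exact ⟨x, hx⟩
          have m1 : MeasurableSet {x | ENNReal.ofReal t < u x} := measurableSet_lt measurable_const hu
          have m2 : MeasurableSet {x | ENNReal.ofReal t < v x} := measurableSet_lt measurable_const hv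
          have bm := volume_add_volume_le (m1.const_smul₀ a) (m2.const_smul₀ b)
            (n1.smul_set) (n2.smul_set)
          rw [Measure.addHaar_smul, Measure.addHaar_smul] at bm
          simp only [Module.finrank_self, pow_one, abs_of_pos ha, abs_of_pos hb] at bm
          refine bm.trans (measure_mono ?_)
          rintro _ ⟨_, ⟨x, hx, rfl⟩, _, ⟨y, hy, rfl⟩, rfl⟩
          simp only [Set.mem_ofPred_eq, smul_eq_mul] at hx hy ⊢
          refine lt_min (lt_of_lt_of_le ?_ (h x y)) h1
          have ht0 : ENNReal.ofReal t ≠ 0 := by simpa using ht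
          calc ENNReal.ofReal t = ENNReal.ofReal t ^ a * ENNReal.ofReal t ^ b := by
                rw [← ENNReal.rpow_add _ _ ht0 ENNReal.ofReal_ne_top, hab, ENNReal.rpow_one]
            _ < u x ^ a * v y ^ b :=
                ENNReal.mul_lt_mul (ENNReal.rpow_lt_rpow hx ha) (ENNReal.rpow_lt_rpow hy hb)
    _ = ∫⁻ x, min (w x) 1 := (layer _ (hw.min measurable_const) fun x => min_le_right _ _).symm
    _ ≤ ∫⁻ x, w x := lintegral_mono fun x => min_le_left _ _

theorem prekopa_leindler_real_of_bounded {a b : ℝ} (ha : 0 < a) (hb : 0 < b) (hab : a + b = 1)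
    {u v w : ℝ → ℝ≥0∞} (hu : Measurable u) (hv : Measurable v) (hw : Measurable w)
    (hu1 : ⨆ x, u x ≠ ∞) (hv1 : ⨆ x, v x ≠ ∞)
    (h : ∀ x y, u x ^ a * v y ^ b ≤ w (a * x + b * y)) :
    (∫⁻ x, u x) ^ a * (∫⁻ x, v x) ^ b ≤ ∫⁻ x, w x := by
  set U := ⨆ x, u x with hU
  set V := ⨆ x, v x with hV
  rcases eq_or_ne U 0 with h0 | hU0
  · have : ∀ x, u x = 0 := fun x => le_antisymm (h0 ▸ le_iSup u x) zero_le
    simp [this, ha]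
  rcases eq_or_ne V 0 with h0 | hV0
  · have : ∀ x, v x = 0 := fun x => le_antisymm (h0 ▸ le_iSup v x) zero_le
    simp [this, hb]
  have hUa : U ^ a ≠ 0 := by simp [hU0, hu1]
  have hVb : V ^ b ≠ 0 := by simp [hV0, hv1]
  have hUa' : U ^ a ≠ ∞ := ENNReal.rpow_ne_top_of_nonneg ha.le hu1
  have hVb' : V ^ b ≠ ∞ := ENNReal.rpow_ne_top_of_nonneg hb.le hv1
  set c := U ^ a * V ^ b with hc
  have hc0 : c ≠ 0 := mul_ne_zero hUa hVb
  have hct : c ≠ ∞ := ENNReal.mul_ne_top hUa' hVb'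
  have hcinv : (U⁻¹) ^ a * (V⁻¹) ^ b = c⁻¹ := by
    rw [ENNReal.inv_rpow, ENNReal.inv_rpow, hc, ENNReal.mul_inv (.inl hUa) (.inl hUa')]
  have key := lintegral_convexComb_le_of_iSup_eq_one ha hb hab (u := fun x => U⁻¹ * u x)
    (v := fun x => V⁻¹ * v x) (w := fun x => c⁻¹ * w x) (hu.const_mul _) (hv.const_mul _)
    (hw.const_mul _) (by rw [← ENNReal.mul_iSup, ← hU, ENNReal.inv_mul_cancel hU0 hu1])
    (by rw [← ENNReal.mul_iSup, ← hV, ENNReal.inv_mul_cancel hV0 hv1])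
    (fun x y => by
      rw [ENNReal.mul_rpow_of_nonneg _ _ ha.le, ENNReal.mul_rpow_of_nonneg _ _ hb.le,
        mul_mul_mul_comm, hcinv]
      gcongr
      exact h x y)
  have key' := (ENNReal.geom_mean_le_arith_mean2_weighted ha hb hab _ _).trans key
  rw [lintegral_const_mul _ hu, lintegral_const_mul _ hv, lintegral_const_mul _ hw,
    ENNReal.mul_rpow_of_nonneg _ _ ha.le, ENNReal.mul_rpow_of_nonneg _ _ hb.le,
        mul_mul_mul_comm, hcinv] at key'
  exact (ENNReal.mul_le_mul_iff_right (ENNReal.inv_ne_zero.2 hct) (ENNReal.inv_ne_top.2 hc0)).1 key'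

/-- The one-dimensional Prékopa-Leindler inequality. -/
theorem prekopa_leindler_real {a b : ℝ} (ha : 0 < a) (hb : 0 < b) (hab : a + b = 1)
    {u v w : ℝ → ℝ≥0∞} (hu : Measurable u) (hv : Measurable v) (hw : Measurable w)
    (h : ∀ x y, u x ^ a * v y ^ b ≤ w (a * x + b * y)) :
    (∫⁻ x, u x) ^ a * (∫⁻ x, v x) ^ b ≤ ∫⁻ x, w x := by
  have trunc : ∀ g : ℝ → ℝ≥0∞, Measurable g → Filter.Tendsto
      (fun k : ℕ => ∫⁻ x, min (g x) k) Filter.atTop (nhds (∫⁻ x, g x)) := by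
    intro g hg
    refine lintegral_tendsto_of_tendsto_of_monotone
      (fun k => (hg.min measurable_const).aemeasurable)
      (Filter.Eventually.of_forall fun x k l hkl => min_le_min_left _ (Nat.cast_le.2 hkl))
      (Filter.Eventually.of_forall fun x => ?_)
    have := (tendsto_const_nhds (x := g x)).min ENNReal.tendsto_nat_nhds_top
    simpa using this
  rcases eq_or_ne (∫⁻ x, u x) 0 with h0 | hu0
  · simp [h0, ha]
  rcases eq_or_ne (∫⁻ x, v x) 0 with h0 | hv0
  · simp [h0, hb]
  have hlim := ENNReal.Tendsto.mul ((trunc u hu).ennrpow_const a) (.inl (by simp [hu0, ha.le]))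
    ((trunc v hv).ennrpow_const b) (.inl (by simp [hv0, hb.le]))
  refine le_of_tendsto' hlim fun k => ?_
  have bdd : ∀ g : ℝ → ℝ≥0∞, ⨆ x, min (g x) (k : ℝ≥0∞) ≠ ∞ := fun g =>
    ((iSup_le fun x => min_le_right _ _).trans_lt (ENNReal.natCast_lt_top k)).ne
  refine prekopa_leindler_real_of_bounded ha hb hab (hu.min measurable_const)
    (hv.min measurable_const) hw (bdd u) (bdd v) fun x y => le_trans ?_ (h x y)
  gcongr <;> exact min_le_left _ _

/-- The Prékopa-Leindler inequality. -/
theorem prekopa_leindler {a b : ℝ} (ha : 0 < a) (hb : 0 < b) (hab : a + b = 1) (n : ℕ)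
    {u v w : (Fin n → ℝ) → ℝ≥0∞} (hu : Measurable u) (hv : Measurable v) (hw : Measurable w)
    (h : ∀ x y, u x ^ a * v y ^ b ≤ w (a • x + b • y)) :
    (∫⁻ x, u x) ^ a * (∫⁻ x, v x) ^ b ≤ ∫⁻ x, w x := by
  induction n with
  | zero =>
    have e : ∀ g : (Fin 0 → ℝ) → ℝ≥0∞, ∫⁻ x, g x = g default := fun g => by
      rw [volume_pi, Measure.pi_of_empty _ default, lintegral_dirac]
    rw [e, e, e]
    exact (h default default).trans_eq (congrArg w (Subsingleton.elim _ _))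
  | succ n ih =>
    let E := (MeasurableEquiv.piFinSuccAbove (fun _ : Fin (n + 1) => ℝ) 0).symm
    have hE : ∀ s y, E (s, y) = Fin.cons s y := fun s y => by
      simp [E, MeasurableEquiv.piFinSuccAbove, Fin.insertNthEquiv]
    have slice : ∀ g : (Fin (n + 1) → ℝ) → ℝ≥0∞, Measurable g →
        ∫⁻ x, g x = ∫⁻ s, ∫⁻ y, g (E (s, y)) := by
      intro g hg
      rw [← ((volume_preserving_piFinSuccAbove (fun _ : Fin (n + 1) => ℝ) 0).symm).lintegral_comp hg]
      exact lintegral_prod _ (hg.comp E.measurable).aemeasurable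
    have mslice : ∀ g : (Fin (n + 1) → ℝ) → ℝ≥0∞, Measurable g →
        Measurable fun s => ∫⁻ y, g (E (s, y)) := fun g hg =>
      (hg.comp E.measurable).lintegral_prod_right'
    rw [slice u hu, slice v hv, slice w hw]
    refine prekopa_leindler_real ha hb hab (mslice u hu) (mslice v hv) (mslice w hw) fun s t => ?_
    have mp : ∀ s, Measurable fun y => E (s, y) := fun s => E.measurable.comp measurable_prodMk_left
    refine ih (hu.comp (mp s)) (hv.comp (mp t)) (hw.comp (mp _)) fun x y => ?_
    refine (h _ _).trans_eq ?_
    congr 1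
    rw [hE, hE, hE]
    ext i
    refine Fin.cases ?_ (fun j => ?_) i <;> simp

theorem ConcaveOn.exists_le_add_mul {S : Set ℝ} {g : ℝ → ℝ} (hg : ConcaveOn ℝ S g) {x : ℝ}
    (hx : x ∈ interior S) : ∃ c, ∀ t ∈ S, g t ≤ g x + c * (t - x) := by
  have hc : ConvexOn ℝ S (-g) := hg.neg
  refine ⟨-derivWithin (-g) (Set.Ioi x) x, fun t ht => ?_⟩
  rcases lt_trichotomy t x with h | rfl | h
  · have h1 := (hc.slope_le_leftDeriv_of_mem_interior ht hx h).trans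
      (hc.leftDeriv_le_rightDeriv_of_mem_interior hx)
    rw [slope_def_field, div_le_iff₀ (by linarith)] at h1
    simp only [Pi.neg_apply] at h1
    linarith
  · simp
  · have h1 := hc.rightDeriv_le_slope_of_mem_interior hx ht h
    rw [slope_def_field, le_div_iff₀ (by linarith)] at h1
    simp only [Pi.neg_apply] at h1
    linarith

/-- A concave monotone function can be separated by an affine function on the two sides of any
interval. -/
theorem ConcaveOn.exists_affine_separating {ψ : ℝ → ℝ} (hψ : ConcaveOn ℝ (Set.Ici 0) ψ)
    (hmono : MonotoneOn ψ (Set.Ici 0)) {J : Set ℝ} (hJ : J.OrdConnected) (hJ0 : J ⊆ Set.Ioi 0) :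
    ∃ c₀ c₁ : ℝ, ∀ s, 0 < s → (s ∈ J → c₀ + c₁ * s ≤ ψ s) ∧ (s ∉ J → ψ s ≤ c₀ + c₁ * s) := by
  have tangent : ∀ x, 0 < x → ∃ c₀ c₁ : ℝ, c₀ + c₁ * x = ψ x ∧ ∀ s, 0 < s → ψ s ≤ c₀ + c₁ * s := by
    intro x hx
    obtain ⟨c, hc⟩ := hψ.exists_le_add_mul (x := x) (by simpa using hx)
    refine ⟨ψ x - c * x, c, by ring, fun s hs => ?_⟩
    have := hc s hs.le
    linarith
  rcases J.eq_empty_or_nonempty with rfl | hne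
  · obtain ⟨c₀, c₁, -, h⟩ := tangent 1 one_pos
    exact ⟨c₀, c₁, fun s hs => ⟨fun h => h.elim, fun _ => h s hs⟩⟩
  have hbelow : BddBelow J := ⟨0, fun x hx => (hJ0 hx).le⟩
  have ha0 : 0 ≤ sInf J := le_csInf hne fun x hx => (hJ0 hx).le
  by_cases hab : BddAbove J
  · rcases (csInf_le_csSup hne hbelow hab).eq_or_lt with heq | hlt
    · have hJs : ∀ s ∈ J, s = sInf J := fun s hs =>
        le_antisymm (heq ▸ le_csSup hab hs) (csInf_le hbelow hs)
      obtain ⟨y, hy⟩ := hne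
      obtain ⟨c₀, c₁, he, h⟩ := tangent (sInf J) (hJs y hy ▸ hJ0 hy)
      refine ⟨c₀, c₁, fun s hs => ⟨fun hsJ => ?_, fun _ => h s hs⟩⟩
      rw [hJs s hsJ, he]
    · set a := sInf J
      set b := sSup J
      have hba : 0 < b - a := sub_pos.2 hlt
      have hb0 : 0 < b := ha0.trans_lt hlt
      set c := (ψ b - ψ a) / (b - a) with hc
      have hcb : c * (b - a) = ψ b - ψ a := div_mul_cancel₀ _ hba.ne'
      refine ⟨ψ a - c * a, c, fun s hs => ⟨fun hsJ => ?_, fun hsJ => ?_⟩⟩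
      · have has : a ≤ s := csInf_le hbelow hsJ
        have hsb : s ≤ b := le_csSup hab hsJ
        have h := hψ.2 (Set.mem_Ici.2 ha0) (Set.mem_Ici.2 hb0.le) (div_nonneg (sub_nonneg.2 hsb) hba.le)
          (div_nonneg (sub_nonneg.2 has) hba.le) (by field_simp; ring)
        have e : ((b - s) / (b - a)) • a + ((s - a) / (b - a)) • b = s := by
          simp only [smul_eq_mul]; field_simp; ring
        rw [e] at h
        refine le_trans (le_of_eq ?_) h
        simp only [smul_eq_mul, hc]; field_simp; ring
      · have hout : s ≤ a ∨ b ≤ s := by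
          by_contra! hcon
          obtain ⟨x, hx, hxs⟩ := exists_lt_of_csInf_lt hne hcon.1
          obtain ⟨y, hy, hsy⟩ := exists_lt_of_lt_csSup hne hcon.2
          exact hsJ (hJ.out hx hy ⟨hxs.le, hsy.le⟩)
        rcases hout with h | h
        · rcases h.eq_or_lt with rfl | h
          · linarith
          have := hψ.slope_anti_adjacent (x := s) (y := a) (z := b) hs.le hb0.le h hlt
          rw [← hc, le_div_iff₀ (by linarith)] at this
          linarith
        · rcases h.eq_or_lt with rfl | h
          · linarith
          have := hψ.slope_anti_adjacent (x := a) (y := b) (z := s) ha0 hs.le hlt h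
          rw [← hc, div_le_iff₀ (by linarith)] at this
          linarith
  · refine ⟨ψ (sInf J), 0, fun s hs => ⟨fun hsJ => ?_, fun hsJ => ?_⟩⟩
    · simpa using hmono ha0 hs.le (csInf_le hbelow hsJ)
    · have : s ≤ sInf J := by
        by_contra! hcon
        obtain ⟨x, hx, hxs⟩ := exists_lt_of_csInf_lt hne hcon
        obtain ⟨y, hy, hsy⟩ := not_bddAbove_iff.1 hab s
        exact hsJ (hJ.out hx hy ⟨hxs.le, hsy.le⟩)
      simpa using hmono hs.le ha0 this

theorem exists_rpow_separating {I : Set ℝ} (hI : I.OrdConnected) {r R : ℝ} (hr : 0 < r)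
    (hrR : r < R) : ∃ c₀ c₁ : ℝ, ∀ t, 0 < t →
      (t ∈ I → c₀ + c₁ * t ^ R ≤ t ^ r) ∧ (t ∉ I → t ^ r ≤ c₀ + c₁ * t ^ R) := by
  have hR : 0 < R := hr.trans hrR
  have hψ : ConcaveOn ℝ (Set.Ici 0) fun s : ℝ => s ^ (r / R) :=
    Real.concaveOn_rpow (by positivity) ((div_le_one hR).2 hrR.le)
  have hmono : MonotoneOn (fun s : ℝ => s ^ (r / R)) (Set.Ici 0) :=
    fun x hx y _ hxy => Real.rpow_le_rpow hx hxy (by positivity)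
  have hJ : {s : ℝ | 0 < s ∧ s ^ R⁻¹ ∈ I}.OrdConnected := by
    refine ⟨fun x hx y hy s hs => ⟨hx.1.trans_le hs.1, hI.out hx.2 hy.2 ⟨?_, ?_⟩⟩⟩
    · exact Real.rpow_le_rpow hx.1.le hs.1 (by positivity)
    · exact Real.rpow_le_rpow (hx.1.le.trans hs.1) hs.2 (by positivity)
  obtain ⟨c₀, c₁, h⟩ := hψ.exists_affine_separating hmono hJ fun s hs => hs.1
  refine ⟨c₀, c₁, fun t ht => ?_⟩
  have hmem : t ^ R ∈ {s : ℝ | 0 < s ∧ s ^ R⁻¹ ∈ I} ↔ t ∈ I := by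
    simp only [Set.mem_ofPred_eq, Real.rpow_pos_of_pos ht, true_and, ← Real.rpow_mul ht.le,
      mul_inv_cancel₀ hR.ne', Real.rpow_one]
  have := h (t ^ R) (Real.rpow_pos_of_pos ht _)
  rw [hmem] at this
  simpa only [← Real.rpow_mul ht.le, mul_div_cancel₀ _ hR.ne'] using this

theorem integrableOn_rpow_mul_exp_neg_mul {q B : ℝ} (hq : 0 < q) (hB : 0 < B) :
    IntegrableOn (fun t : ℝ => t ^ (q - 1) * exp (-(B * t))) (Set.Ioi 0) := by
  by_contra h
  have h1 := integral_rpow_mul_exp_neg_mul_Ioi hq hB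
  rw [integral_undef h] at h1
  have : 0 < (1 / B) ^ q * Gamma q := mul_pos (by positivity) (Gamma_pos_of_pos hq)
  linarith

/-- Borell's theorem on the normalized Mellin transform of a log-concave function. -/
theorem concaveOn_log_mellin_div_gamma {g : ℝ → ℝ} (hpos : ∀ t, 0 < t → 0 < g t)
    (hg : ConcaveOn ℝ (Set.Ioi 0) fun t => log (g t))
    (hint : ∀ q : ℝ, 0 < q → IntegrableOn (fun t => t ^ (q - 1) * g t) (Set.Ioi 0)) :
    ConcaveOn ℝ (Set.Ioi 0)
      fun q => log ((∫ t in Set.Ioi (0 : ℝ), t ^ (q - 1) * g t) / Gamma q) := by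
  set M : ℝ → ℝ := fun q => ∫ t in Set.Ioi (0 : ℝ), t ^ (q - 1) * g t with hM
  have hMpos : ∀ q, 0 < q → 0 < M q := by
    intro q hq
    refine (setIntegral_pos_iff_support_of_nonneg_ae ?_ (hint q hq)).2 ?_
    · filter_upwards [ae_restrict_mem measurableSet_Ioi] with t ht
      exact mul_nonneg (Real.rpow_nonneg (le_of_lt ht) _) (hpos t ht).le
    · have : Function.support (fun t => t ^ (q - 1) * g t) ∩ Set.Ioi 0 = Set.Ioi (0 : ℝ) :=
        Set.inter_eq_right.2 fun t ht =>
          (mul_pos (Real.rpow_pos_of_pos ht _) (hpos t ht)).ne'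
      rw [this]; simp
  refine LinearOrder.concaveOn_of_lt (convex_Ioi 0) ?_
  intro p (hp : 0 < p) q (hq : 0 < q) hpq a b ha hb hab
  set r := a • p + b • q with hr
  have hrp : r - p = b * (q - p) := by
    simp only [hr, smul_eq_mul]; linear_combination p * hab
  have hr0 : 0 < r := by
    have := mul_pos hb (sub_pos.2 hpq)
    linarith
  set lp := log (M p / Gamma p) with hlp
  set lq := log (M q / Gamma q) with hlq
  set κ := (lp - lq) / (q - p) with hκ
  have hκ' : κ * (q - p) = lp - lq := div_mul_cancel₀ _ (sub_pos.2 hpq).ne'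
  set h : ℝ → ℝ := fun t => exp (lp + p * κ) * exp (-(exp κ * t)) with hh
  have hhint : ∀ s : ℝ, 0 < s → IntegrableOn (fun t => t ^ (s - 1) * h t) (Set.Ioi 0) := by
    intro s hs
    refine ((integrableOn_rpow_mul_exp_neg_mul hs (exp_pos κ)).const_mul (exp (lp + p * κ))).congr
      (.of_forall fun t => ?_)
    simp only [hh]; ring
  have hhval : ∀ s, 0 < s → ∫ t in Set.Ioi (0 : ℝ), t ^ (s - 1) * h t =
      exp (lp + p * κ - s * κ) * Gamma s := by
    intro s hs
    have e : (1 / exp κ) ^ s = exp (-(s * κ)) := by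
      rw [one_div, ← Real.exp_neg, ← Real.exp_mul]; ring_nf
    calc _ = ∫ t in Set.Ioi (0 : ℝ), exp (lp + p * κ) * (t ^ (s - 1) * exp (-(exp κ * t))) := by
          refine integral_congr_ae (.of_forall fun t => ?_)
          simp only [hh]; ring
      _ = _ := by
          rw [integral_const_mul, integral_rpow_mul_exp_neg_mul_Ioi hs (exp_pos κ), e, ← mul_assoc,
            ← Real.exp_add, sub_eq_add_neg]
  have hexp : ∀ s, 0 < s → exp (log (M s / Gamma s)) * Gamma s = M s := fun s hs => by
    rw [Real.exp_log (div_pos (hMpos s hs) (Gamma_pos_of_pos hs)),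
      div_mul_cancel₀ _ (Gamma_pos_of_pos hs).ne']
  have hp_eq : ∫ t in Set.Ioi (0 : ℝ), t ^ (p - 1) * h t = M p := by
    rw [hhval p hp, add_sub_cancel_right, hexp p hp]
  have hq_eq : ∫ t in Set.Ioi (0 : ℝ), t ^ (q - 1) * h t = M q := by
    rw [hhval q hq, ← hexp q hq]
    congr 2
    linarith
  have hI : {t | t ∈ Set.Ioi (0 : ℝ) ∧ lp + p * κ ≤ log (g t) + exp κ * t}.OrdConnected := by
    refine Convex.ordConnected (ConcaveOn.convex_ge ?_ _)
    refine hg.add ⟨convex_Ioi 0, fun x _ y _ a b _ _ _ => le_of_eq ?_⟩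
    simp only [smul_eq_mul]; ring
  have hmem : ∀ t, 0 < t →
      (t ∈ {t | t ∈ Set.Ioi (0 : ℝ) ∧ lp + p * κ ≤ log (g t) + exp κ * t} ↔ h t ≤ g t) := by
    intro t ht
    simp only [Set.mem_ofPred_eq, Set.mem_Ioi, ht, true_and, hh, ← Real.exp_add]
    rw [← Real.le_log_iff_exp_le (hpos t ht)]
    constructor <;> intro <;> linarith
  obtain ⟨c₀, c₁, hc⟩ := exists_rpow_separating hI (r := r - p) (R := q - p)
    (by rw [hrp]; exact mul_pos hb (sub_pos.2 hpq)) (by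
      rw [hrp]; exact mul_lt_of_lt_one_left (sub_pos.2 hpq) (by linarith))
  have hd : ∀ s : ℝ, 0 < s → IntegrableOn (fun t => t ^ (s - 1) * g t - t ^ (s - 1) * h t)
    (Set.Ioi 0) := fun s hs => (hint s hs).sub (hhint s hs)
  have hdval : ∀ s, 0 < s → ∫ t in Set.Ioi (0 : ℝ), (t ^ (s - 1) * g t - t ^ (s - 1) * h t) =
      M s - ∫ t in Set.Ioi (0 : ℝ), t ^ (s - 1) * h t := fun s hs =>
    integral_sub (hint s hs) (hhint s hs)
  have hle : ∫ t in Set.Ioi (0 : ℝ), (c₀ * (t ^ (p - 1) * g t - t ^ (p - 1) * h t) +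
        c₁ * (t ^ (q - 1) * g t - t ^ (q - 1) * h t)) ≤
      ∫ t in Set.Ioi (0 : ℝ), (t ^ (r - 1) * g t - t ^ (r - 1) * h t) := by
    refine setIntegral_mono_on (((hd p hp).const_mul c₀).add ((hd q hq).const_mul c₁)) (hd r hr0)
      measurableSet_Ioi fun t (ht : 0 < t) => ?_
    have eq1 : t ^ (q - 1) = t ^ (p - 1) * t ^ (q - p) := by
      rw [← Real.rpow_add ht]; ring_nf
    have er1 : t ^ (r - 1) = t ^ (p - 1) * t ^ (r - p) := by
      rw [← Real.rpow_add ht]; ring_nf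
    have hprod : 0 ≤ (t ^ (r - p) - (c₀ + c₁ * t ^ (q - p))) * (g t - h t) := by
      by_cases hgt : h t ≤ g t
      · exact mul_nonneg (sub_nonneg.2 ((hc t ht).1 ((hmem t ht).2 hgt))) (sub_nonneg.2 hgt)
      · exact mul_nonneg_of_nonpos_of_nonpos
          (sub_nonpos.2 ((hc t ht).2 (mt (hmem t ht).1 hgt))) (by linarith)
    have := mul_nonneg (Real.rpow_nonneg ht.le (p - 1)) hprod
    rw [eq1, er1]
    nlinarith
  rw [integral_add ((hd p hp).const_mul c₀) ((hd q hq).const_mul c₁), integral_const_mul,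
    integral_const_mul, hdval p hp, hdval q hq, hdval r hr0, hp_eq, hq_eq, sub_self, sub_self,
    mul_zero, mul_zero, add_zero, hhval r hr0, sub_nonneg] at hle
  rw [Real.le_log_iff_exp_le (div_pos (hMpos r hr0) (Gamma_pos_of_pos hr0)),
    le_div_iff₀ (Gamma_pos_of_pos hr0)]
  refine le_trans (le_of_eq ?_) hle
  congr 2
  simp only [smul_eq_mul]
  linear_combination κ * hrp + b * hκ' + lp * hab

/-- A positive log-concave function on the half-line with one finite moment has exponential decay. -/
theorem exists_le_exp_of_concaveOn_log {g : ℝ → ℝ} (hpos : ∀ t, 0 < t → 0 < g t)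
    (hg : ConcaveOn ℝ (Set.Ioi 0) fun t => log (g t)) {q : ℝ} (hq : 0 < q)
    (hint : IntegrableOn (fun t => t ^ (q - 1) * g t) (Set.Ioi 0)) :
    ∃ A B : ℝ, 0 < B ∧ ∀ t, 0 < t → g t ≤ A * exp (-(B * t)) := by
  have hex : ∃ x y, 0 < x ∧ x < y ∧ g y < g x := by
    by_contra! hcon
    have hge : ∀ t, 1 < t → g 1 ≤ g t := fun t ht => hcon 1 t one_pos ht
    have h1 : IntegrableOn (fun t : ℝ => t ^ (q - 1)) (Set.Ioi 1) := by
      refine Integrable.mono' ((hint.mono_set (Set.Ioi_subset_Ioi zero_le_one)).const_mul (g 1)⁻¹)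
        (by fun_prop) ?_
      filter_upwards [ae_restrict_mem measurableSet_Ioi] with t ht
      have ht0 : (0 : ℝ) < t := one_pos.trans ht
      have hg1 := hpos 1 one_pos
      rw [Real.norm_of_nonneg (Real.rpow_nonneg ht0.le _), inv_mul_eq_div, le_div_iff₀ hg1]
      exact mul_le_mul_of_nonneg_left (hge t ht) (Real.rpow_nonneg ht0.le _)
    rw [integrableOn_Ioi_rpow_iff one_pos] at h1
    linarith
  obtain ⟨x, y, hx, hxy, hlt⟩ := hex
  have hy : 0 < y := hx.trans hxy
  obtain ⟨c, hc⟩ := hg.exists_le_add_mul (x := y) (by simpa using hy)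
  have hc0 : c < 0 := by
    have h1 := hc x hx
    have h2 := Real.log_lt_log (hpos y hy) hlt
    nlinarith
  refine ⟨exp (log (g y) - c * y), -c, by linarith, fun t ht => ?_⟩
  rw [← Real.exp_add, ← Real.log_le_iff_le_exp (hpos t ht)]
  have := hc t ht
  linarith

theorem integrableOn_rpow_mul_of_concaveOn_log {g : ℝ → ℝ} (hpos : ∀ t, 0 < t → 0 < g t)
    (hgm : Measurable g) (hg : ConcaveOn ℝ (Set.Ioi 0) fun t => log (g t)) {q : ℝ} (hq : 0 < q)
    (hint : IntegrableOn (fun t => t ^ (q - 1) * g t) (Set.Ioi 0)) {r : ℝ} (hr : 0 < r) :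
    IntegrableOn (fun t => t ^ (r - 1) * g t) (Set.Ioi 0) := by
  obtain ⟨A, B, hB, hAB⟩ := exists_le_exp_of_concaveOn_log hpos hg hq hint
  refine Integrable.mono' ((integrableOn_rpow_mul_exp_neg_mul hr hB).const_mul A)
    (by fun_prop) ?_
  filter_upwards [ae_restrict_mem measurableSet_Ioi] with t (ht : 0 < t)
  have hp := Real.rpow_nonneg ht.le (r - 1)
  rw [Real.norm_of_nonneg (mul_nonneg hp (hpos t ht).le)]
  have := mul_le_mul_of_nonneg_left (hAB t ht) hp
  linarith

theorem Real.Gamma_eq_prod_mul_Gamma_sub {n : ℕ} {p : ℝ} (hp : (n : ℝ) < p) :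
    Gamma p = (∏ i ∈ Finset.Icc 1 n, (p - (i : ℝ))) * Gamma (p - n) := by
  induction n with
  | zero => simp
  | succ n ih =>
    push_cast at hp
    have h := Gamma_add_one (s := p - (n + 1)) (by linarith)
    rw [Finset.prod_Icc_succ_top (by lia), ih (by linarith)]
    push_cast
    rw [mul_assoc, ← h]
    ring_nf

theorem Real.exp_neg_le_mul_rpow_neg {β s : ℝ} (hβ : 0 < β) (hs : 0 < s) :
    exp (-s) ≤ β ^ β * s ^ (-β) := by
  have h1 : s / β ≤ exp (s / β) := by linarith [Real.add_one_le_exp (s / β)]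
  have h2 : (s / β) ^ β ≤ exp s := by
    calc (s / β) ^ β ≤ exp (s / β) ^ β := Real.rpow_le_rpow (by positivity) h1 hβ.le
      _ = exp s := by rw [← Real.exp_mul, div_mul_cancel₀ _ hβ.ne']
  have hs' : 0 < s ^ β := Real.rpow_pos_of_pos hs _
  have hb' : 0 < β ^ β := Real.rpow_pos_of_pos hβ _
  rw [Real.div_rpow hs.le hβ.le, div_le_iff₀ hb'] at h2
  rw [Real.exp_neg, Real.rpow_neg hs.le, ← div_eq_mul_inv, le_div_iff₀ hs',
    inv_mul_le_iff₀ (exp_pos s)]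
  exact h2

section ConvexPower

variable {n : ℕ} {S : Set (Fin n → ℝ)} {φ : (Fin n → ℝ) → ℝ}

theorem integrableOn_exp_neg_mul (hS : MeasurableSet S) (hφm : Measurable φ)
    (hφ : ∀ x ∈ S, 0 < φ x) {β : ℝ} (hβ : 0 < β)
    (hint : IntegrableOn (fun x => φ x ^ (-β)) S) {t : ℝ} (ht : 0 < t) :
    IntegrableOn (fun x => exp (-(t * φ x))) S := by
  refine Integrable.mono' (hint.const_mul (β ^ β * t ^ (-β))) (by fun_prop) ?_
  filter_upwards [ae_restrict_mem hS] with x hx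
  rw [Real.norm_of_nonneg (exp_pos _).le, mul_assoc, ← Real.mul_rpow ht.le (hφ x hx).le]
  exact Real.exp_neg_le_mul_rpow_neg hβ (mul_pos ht (hφ x hx))

theorem lintegral_comp_inv_smul_pi {u : (Fin n → ℝ) → ℝ≥0∞} (hu : Measurable u) {t : ℝ}
    (ht : 0 < t) : ∫⁻ y, u (t⁻¹ • y) = ENNReal.ofReal (t ^ n) * ∫⁻ x, u x := by
  rw [← lintegral_map hu (measurable_const_smul _),
    Measure.map_addHaar_smul volume (inv_ne_zero ht.ne'), lintegral_smul_measure]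
  simp [abs_of_pos ht]

/-- Log-concavity of the Laplace-type transform of a convex function, in homogenized form. -/
theorem concaveOn_log_pow_mul_integral_exp (hS : MeasurableSet S) (hφm : Measurable φ)
    (hφ : ConvexOn ℝ S φ) (hint : ∀ t : ℝ, 0 < t → IntegrableOn (fun x => exp (-(t * φ x))) S)
    (hpos : ∀ t : ℝ, 0 < t → 0 < ∫ x in S, exp (-(t * φ x))) :
    ConcaveOn ℝ (Set.Ioi 0) fun t : ℝ => log (t ^ n * ∫ x in S, exp (-(t * φ x))) := by
  refine LinearOrder.concaveOn_of_lt (convex_Ioi 0) ?_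
  intro s (hs : 0 < s) t (ht : 0 < t) _ a b ha hb hab
  have hr : 0 < a • s + b • t := add_pos (mul_pos ha hs) (mul_pos hb ht)
  set r := a • s + b • t with hrdef
  set U : ℝ → (Fin n → ℝ) → ℝ≥0∞ := fun t => S.indicator fun x => ENNReal.ofReal (exp (-(t * φ x)))
    with hU
  have hUm : ∀ t, Measurable (U t) := fun t => Measurable.indicator (by fun_prop) hS
  have hUint : ∀ t, 0 < t → ∫⁻ y, U t (t⁻¹ • y) =
      ENNReal.ofReal (t ^ n * ∫ x in S, exp (-(t * φ x))) := by
    intro t ht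
    rw [lintegral_comp_inv_smul_pi (hUm t) ht, lintegral_indicator hS,
      ← ofReal_integral_eq_lintegral_ofReal (hint t ht) (.of_forall fun x => (exp_pos _).le),
      ENNReal.ofReal_mul (by positivity)]
  have hPL := prekopa_leindler ha hb hab n
    ((hUm s).comp (measurable_const_smul s⁻¹)) ((hUm t).comp (measurable_const_smul t⁻¹))
    ((hUm r).comp (measurable_const_smul r⁻¹)) (fun x y => by
      simp only [Function.comp_apply]
      by_cases hx : s⁻¹ • x ∈ S
      swap
      · simp [hU, hx, ha]
      by_cases hy : t⁻¹ • y ∈ S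
      swap
      · simp [hU, hy, hb]
      have hw : a * s / r + b * t / r = 1 := by
        rw [← add_div]; exact div_self hr.ne'
      have e : r⁻¹ • (a • x + b • y) = (a * s / r) • s⁻¹ • x + (b * t / r) • t⁻¹ • y := by
        simp only [smul_add, smul_smul]
        congr 2 <;> field_simp
      have hz := hφ.1 hx hy (by positivity) (by positivity) hw
      have hzle := hφ.2 hx hy (by positivity) (by positivity) hw
      rw [← e] at hz hzle
      simp only [hU, Set.indicator_of_mem hx, Set.indicator_of_mem hy, Set.indicator_of_mem hz]
      rw [ENNReal.ofReal_rpow_of_pos (exp_pos _), ENNReal.ofReal_rpow_of_pos (exp_pos _),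
        ← ENNReal.ofReal_mul (by positivity), ← Real.exp_mul, ← Real.exp_mul, ← Real.exp_add]
      refine ENNReal.ofReal_le_ofReal (Real.exp_le_exp.2 ?_)
      have := mul_le_mul_of_nonneg_left hzle hr.le
      have e2 : r * ((a * s / r) • φ (s⁻¹ • x) + (b * t / r) • φ (t⁻¹ • y)) =
          a * s * φ (s⁻¹ • x) + b * t * φ (t⁻¹ • y) := by
        simp only [smul_eq_mul]; field_simp
      linarith)
  simp only [Function.comp_apply] at hPL
  have hGpos : ∀ t : ℝ, 0 < t → 0 < t ^ n * ∫ x in S, exp (-(t * φ x)) := fun t ht =>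
    mul_pos (by positivity) (hpos t ht)
  rw [hUint s hs, hUint t ht, hUint r hr, ENNReal.ofReal_rpow_of_pos (hGpos s hs),
    ENNReal.ofReal_rpow_of_pos (hGpos t ht),
    ← ENNReal.ofReal_mul (Real.rpow_nonneg (hGpos s hs).le _),
    ENNReal.ofReal_le_ofReal_iff (hGpos r hr).le] at hPL
  have := Real.log_le_log (mul_pos (Real.rpow_pos_of_pos (hGpos s hs) _)
    (Real.rpow_pos_of_pos (hGpos t ht) _)) hPL
  rwa [Real.log_mul (Real.rpow_pos_of_pos (hGpos s hs) _).ne'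
    (Real.rpow_pos_of_pos (hGpos t ht) _).ne', Real.log_rpow (hGpos s hs),
    Real.log_rpow (hGpos t ht)] at this

theorem lintegral_rpow_mul_pow_mul_integral_exp (hS : MeasurableSet S) (hφm : Measurable φ)
    (hφ : ∀ x ∈ S, 0 < φ x)
    (hint : ∀ t : ℝ, 0 < t → IntegrableOn (fun x => exp (-(t * φ x))) S) {p : ℝ} (hp : 0 < p) :
    ∫⁻ t in Set.Ioi (0 : ℝ), ENNReal.ofReal (t ^ (p - n - 1) * (t ^ n * ∫ x in S, exp (-(t * φ x))))
      = ENNReal.ofReal (Gamma p) * ∫⁻ x in S, ENNReal.ofReal (φ x ^ (-p)) := by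
  calc _ = ∫⁻ t in Set.Ioi (0 : ℝ), ∫⁻ x in S, ENNReal.ofReal (t ^ (p - 1) * exp (-(φ x * t))) := by
        refine setLIntegral_congr_fun measurableSet_Ioi fun t (ht : 0 < t) => ?_
        have e : t ^ (p - n - 1) * (t ^ n * ∫ x in S, exp (-(t * φ x))) =
            ∫ x in S, t ^ (p - 1) * exp (-(φ x * t)) := by
          rw [integral_const_mul, ← mul_assoc, ← Real.rpow_natCast t n, ← Real.rpow_add ht]
          have e1 : p - n - 1 + n = p - 1 := by ring
          simp only [e1, mul_comm t]
        simp only [e]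
        refine ofReal_integral_eq_lintegral_ofReal ?_ (.of_forall fun x => by positivity)
        simpa only [mul_comm t] using (hint t ht).const_mul (t ^ (p - 1))
    _ = ∫⁻ x in S, ∫⁻ t in Set.Ioi (0 : ℝ), ENNReal.ofReal (t ^ (p - 1) * exp (-(φ x * t))) := by
        refine lintegral_lintegral_swap ?_
        refine Measurable.aemeasurable ?_
        simp only [Function.uncurry_def]
        fun_prop
    _ = ∫⁻ x in S, ENNReal.ofReal (Gamma p) * ENNReal.ofReal (φ x ^ (-p)) := by
        refine setLIntegral_congr_fun hS fun x hx => ?_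
        have h0 := hφ x hx
        rw [← ofReal_integral_eq_lintegral_ofReal (integrableOn_rpow_mul_exp_neg_mul hp h0),
          integral_rpow_mul_exp_neg_mul_Ioi hp h0, ← ENNReal.ofReal_mul (Gamma_pos_of_pos hp).le,
          one_div, Real.inv_rpow h0.le, Real.rpow_neg h0.le, mul_comm]
        filter_upwards [ae_restrict_mem measurableSet_Ioi] with t (ht : 0 < t)
        positivity
    _ = _ := lintegral_const_mul _ (by fun_prop)

theorem concaveOn_log_prod_mul_integral_rpow_neg (hS : MeasurableSet S) (hS0 : volume S ≠ 0)
    (hφm : Measurable φ) (hφ : ∀ x ∈ S, 0 < φ x) (hconv : ConvexOn ℝ S φ) {β : ℝ}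
    (hβ : (n : ℝ) < β) (hint : IntegrableOn (fun x => φ x ^ (-β)) S) :
    ConcaveOn ℝ (Set.Ioi (n : ℝ)) fun p =>
      log ((∏ i ∈ Finset.Icc 1 n, (p - (i : ℝ))) * ∫ x in S, φ x ^ (-p)) := by
  have hn0 : (0 : ℝ) ≤ n := n.cast_nonneg
  have hexp := fun t (ht : 0 < t) =>
    integrableOn_exp_neg_mul hS hφm hφ (hn0.trans_lt hβ) hint ht
  have hmpos : ∀ t : ℝ, 0 < t → 0 < ∫ x in S, exp (-(t * φ x)) := by
    intro t ht
    refine (integral_pos_iff_support_of_nonneg (fun x => (exp_pos _).le) (hexp t ht)).2 ?_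
    have : (Function.support fun x => exp (-(t * φ x))) = Set.univ :=
      Set.eq_univ_of_forall fun x => (exp_pos _).ne'
    rw [this, Measure.restrict_apply_univ]
    exact pos_iff_ne_zero.2 hS0
  set G : ℝ → ℝ := fun t => t ^ n * ∫ x in S, exp (-(t * φ x)) with hG
  have hGpos : ∀ t, 0 < t → 0 < G t := fun t ht => mul_pos (by positivity) (hmpos t ht)
  have hGm : Measurable G := by
    refine (measurable_id.pow_const n).mul ?_
    have : StronglyMeasurable (Function.uncurry fun (t : ℝ) x => exp (-(t * φ x))) := by
      refine Measurable.stronglyMeasurable ?_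
      simp only [Function.uncurry_def]
      fun_prop
    exact (this.integral_prod_right (ν := volume.restrict S)).measurable
  have hGlog : ConcaveOn ℝ (Set.Ioi 0) fun t => log (G t) :=
    concaveOn_log_pow_mul_integral_exp hS hφm hconv hexp hmpos
  have hlin := fun p (hp : 0 < p) =>
    lintegral_rpow_mul_pow_mul_integral_exp (p := p) hS hφm hφ hexp hp
  have hnn : ∀ q : ℝ, 0 ≤ᵐ[volume.restrict (Set.Ioi 0)] fun t => t ^ (q - 1) * G t := by
    intro q
    filter_upwards [ae_restrict_mem measurableSet_Ioi] with t (ht : 0 < t)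
    exact mul_nonneg (Real.rpow_nonneg ht.le _) (hGpos t ht).le
  have hφnn : ∀ p : ℝ, 0 ≤ᵐ[volume.restrict S] fun x => φ x ^ (-p) := by
    intro p
    filter_upwards [ae_restrict_mem hS] with x hx
    exact Real.rpow_nonneg (hφ x hx).le _
  have hGβ : IntegrableOn (fun t => t ^ (β - n - 1) * G t) (Set.Ioi 0) := by
    refine (lintegral_ofReal_ne_top_iff_integrable (by fun_prop) (hnn (β - n))).1 ?_
    rw [hlin β (hn0.trans_lt hβ)]
    exact ENNReal.mul_ne_top ENNReal.ofReal_ne_top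
      ((lintegral_ofReal_ne_top_iff_integrable (hφm.pow_const _).aestronglyMeasurable (hφnn β)).2 hint)
  have hGint : ∀ q : ℝ, 0 < q → IntegrableOn (fun t => t ^ (q - 1) * G t) (Set.Ioi 0) :=
    fun q hq => integrableOn_rpow_mul_of_concaveOn_log hGpos hGm hGlog (sub_pos.2 hβ) hGβ hq
  have hB := concaveOn_log_mellin_div_gamma hGpos hGlog hGint
  have hval : ∀ p : ℝ, (n : ℝ) < p →
      (∏ i ∈ Finset.Icc 1 n, (p - (i : ℝ))) * ∫ x in S, φ x ^ (-p) =
        (∫ t in Set.Ioi (0 : ℝ), t ^ (p - n - 1) * G t) / Gamma (p - n) := by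
    intro p hp
    have hΓ : 0 < Gamma (p - n) := Gamma_pos_of_pos (sub_pos.2 hp)
    have hΓp : 0 < Gamma p := Gamma_pos_of_pos (hn0.trans_lt hp)
    rw [eq_div_iff hΓ.ne', mul_right_comm, ← Real.Gamma_eq_prod_mul_Gamma_sub hp,
      integral_eq_lintegral_of_nonneg_ae (hφnn p) (hφm.pow_const _).aestronglyMeasurable,
      integral_eq_lintegral_of_nonneg_ae (hnn (p - n)) (by fun_prop), hlin p (hn0.trans_lt hp),
      ENNReal.toReal_mul, ENNReal.toReal_ofReal hΓp.le]
  refine ⟨convex_Ioi _, fun p (hp : (n : ℝ) < p) q (hq : (n : ℝ) < q) a b ha hb hab => ?_⟩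
  have hr : (n : ℝ) < a • p + b • q := (convex_Ioi (n : ℝ)) hp hq ha hb hab
  have h := hB.2 (sub_pos.2 hp) (sub_pos.2 hq) ha hb hab
  have e : a • (p - n) + b • (q - n) = a • p + b • q - n := by
    simp only [smul_eq_mul]; linear_combination (-(n : ℝ)) * hab
  simp only [e] at h
  simp only [hval p hp, hval q hq, hval _ hr]
  exact h

end ConvexPower

/-- Let `β > n` and let `X` be a random vector in `ℝⁿ` with density `f` that is
`(-1/β)`-concave, i.e. `f^{-1/β}` is convex on the support of `f`. Then
`α ↦ (∏_{i=1}^n ((1-α)β - i)) E[f(X)^{-α}]` is log-concave on `(-∞, 1 - n/β)`. -/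
theorem stmt11
    {Ω : Type*} [MeasureSpace Ω] [IsProbabilityMeasure (ℙ : Measure Ω)]
    (n : ℕ) (β : ℝ) (hβ : (n : ℝ) < β)
    (X : Ω → (Fin n → ℝ)) (hX : Measurable X)
    (f : (Fin n → ℝ) → ℝ) (hf_nonneg : ∀ x, 0 ≤ f x)
    (hf_density : Measure.map X ℙ = volume.withDensity (fun x => ENNReal.ofReal (f x)))
    (hf_conv : ConvexOn ℝ {x | 0 < f x} (fun x => f x ^ (-1 / β))) :
    ConcaveOn ℝ (Set.Iio (1 - n / β))
      (fun α => Real.log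
        ((∏ i ∈ Finset.Icc 1 n, ((1 - α) * β - (i : ℝ))) * ∫ ω, f (X ω) ^ (-α))) := by
  have hβ0 : 0 < β := n.cast_nonneg.trans_lt hβ
  set S := interior {x | 0 < f x} with hSdef
  have hSsub : S ⊆ {x | 0 < f x} := interior_subset
  have hS : MeasurableSet S := isOpen_interior.measurableSet
  set φ : (Fin n → ℝ) → ℝ := S.indicator fun x => f x ^ (-1 / β) with hφdef
  have hφS : ∀ x ∈ S, φ x = f x ^ (-1 / β) := fun x hx => Set.indicator_of_mem hx _
  have hφm : Measurable φ := by
    classical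
    have := hf_conv.continuousOn_interior.measurable_piecewise
      (continuousOn_const (c := (0 : ℝ))) hS
    rw [hφdef, ← Set.piecewise_eq_indicator]
    exact this
  have hφ : ∀ x ∈ S, 0 < φ x := fun x hx => by
    rw [hφS x hx]; exact Real.rpow_pos_of_pos (hSsub hx) _
  have hconv : ConvexOn ℝ S φ :=
    (hf_conv.subset hSsub hf_conv.1.interior).congr fun x hx => (hφS x hx).symm
  have hfφ : f =ᵐ[volume] S.indicator fun x => φ x ^ (-β) := by
    have hnull : ∀ᵐ x, x ∉ frontier {x | 0 < f x} :=
      measure_eq_zero_iff_ae_notMem.1 (hf_conv.1.addHaar_frontier volume)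
    filter_upwards [hnull] with x hx
    by_cases hxS : x ∈ S
    · have h0 : 0 < f x := hSsub hxS
      rw [Set.indicator_of_mem hxS, hφS x hxS, ← Real.rpow_mul h0.le]
      field_simp
      simp
    · rw [Set.indicator_of_notMem hxS]
      by_contra hne
      exact hx ⟨subset_closure (lt_of_le_of_ne (hf_nonneg x) (Ne.symm hne)), hxS⟩
  have hfm : AEMeasurable f := ⟨_, (hφm.pow_const _).indicator hS, hfφ⟩
  have hprob : IsProbabilityMeasure (Measure.map X ℙ) :=
    Measure.isProbabilityMeasure_map hX.aemeasurable
  have htotal : ∫⁻ x in S, ENNReal.ofReal (φ x ^ (-β)) = 1 := by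
    have h1 := hprob.measure_univ
    rw [hf_density, withDensity_apply _ MeasurableSet.univ, Measure.restrict_univ] at h1
    rw [← h1, ← lintegral_indicator hS]
    refine lintegral_congr_ae ?_
    filter_upwards [hfφ] with x hx
    rw [hx]
    by_cases hxS : x ∈ S <;> simp [hxS]
  have hS0 : volume S ≠ 0 := fun h0 => by
    rw [setLIntegral_measure_zero S _ h0] at htotal
    exact zero_ne_one htotal
  have hint : IntegrableOn (fun x => φ x ^ (-β)) S := by
    refine (lintegral_ofReal_ne_top_iff_integrable (hφm.pow_const _).aestronglyMeasurable ?_).1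
      (by simp [htotal])
    filter_upwards [ae_restrict_mem hS] with x hx
    exact Real.rpow_nonneg (hφ x hx).le _
  have hval : ∀ α : ℝ, ∫ ω, f (X ω) ^ (-α) = ∫ x in S, φ x ^ (-((1 - α) * β)) := by
    intro α
    have hac : Measure.map X ℙ ≪ volume := by
      rw [hf_density]; exact withDensity_absolutelyContinuous _ _
    have hfm' : AEMeasurable (fun x => f x ^ (-α)) (Measure.map X ℙ) :=
      (hfm.mono_ac hac).pow_const _
    rw [← integral_map hX.aemeasurable hfm'.aestronglyMeasurable, hf_density,
      integral_withDensity_eq_integral_toReal_smul₀ hfm.ennreal_ofReal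
        (.of_forall fun x => ENNReal.ofReal_lt_top), ← integral_indicator hS]
    refine integral_congr_ae ?_
    filter_upwards [hfφ] with x hx
    rw [ENNReal.toReal_ofReal (hf_nonneg x), hx, smul_eq_mul]
    by_cases hxS : x ∈ S
    · have h0 := hφ x hxS
      rw [Set.indicator_of_mem hxS, Set.indicator_of_mem hxS, ← Real.rpow_mul h0.le,
        ← Real.rpow_add h0]
      ring_nf
    · simp [hxS]
  have key := concaveOn_log_prod_mul_integral_rpow_neg hS hS0 hφm hφ hconv hβ hint
  have hmem : ∀ α : ℝ, α < 1 - n / β → (n : ℝ) < (1 - α) * β := fun α hα => by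
    rw [← div_lt_iff₀ hβ0]; linarith
  refine ⟨convex_Iio _, fun x hx y hy a b ha hb hab => ?_⟩
  have h := key.2 (hmem x hx) (hmem y hy) ha hb hab
  have e : a • ((1 - x) * β) + b • ((1 - y) * β) = (1 - (a • x + b • y)) * β := by
    simp only [smul_eq_mul]; linear_combination β * hab
  simp only [e] at h
  simp only [hval]
  exact h
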